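/- arXiv:1311.0028 — 2 statements merged into one kernel-verified Lean document; each statement's English description precedes it below -/
import Mathlib

section
/- Existence of nested dyadic grids associated with LGL grids: there exist constants A, B with 0 < A ≤ B, a constant C ≥ 1, and constants c₁, c₂ > 0 such that for every integer N ≥ 1 there is a dyadic partition P_N of [−1,1] with associated dyadic grid 𝒟_N satisfying: (i) 𝒟_N is symmetric and monotonic; (ii) 𝒟_N is locally quasi-uniform with constant C; (iii) the grids are nested, i.e., 𝒟_N ⊆ 𝒟_{N+1} as sets of points, for all N ≥ 1; (iv) 𝒟_N is locally (A,B)-uniformly equivalent to the LGL grid of order N; and (v) c₁·N ≤ #𝒟_N ≤ c₂·N. -/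
/-- The Legendre polynomial of degree `N` via the Rodrigues formula. -/
noncomputable def legendrePoly (N : ℕ) : Polynomial ℝ :=
  Polynomial.C (1 / (2 ^ N * N.factorial : ℝ)) *
    Polynomial.derivative^[N] ((Polynomial.X ^ 2 - 1) ^ N)

/-- The polynomial `(1 - x²)·L_N'(x)` whose zeros are the LGL nodes of order `N`. -/
noncomputable def lglPoly (N : ℕ) : Polynomial ℝ :=
  (1 - Polynomial.X ^ 2) * Polynomial.derivative (legendrePoly N)

/-- `ξ 0 < ξ 1 < ⋯ < ξ N` enumerates the Legendre-Gauss-Lobatto nodes of order `N`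
in increasing order. -/
def IsLGLNodes (N : ℕ) (ξ : ℕ → ℝ) : Prop :=
  StrictMonoOn ξ (Set.Iic N) ∧ ξ 0 = -1 ∧ ξ N = 1 ∧
    (∀ k ≤ N, (lglPoly N).eval (ξ k) = 0) ∧
    (∀ x : ℝ, (lglPoly N).eval x = 0 → ∃ k ≤ N, ξ k = x)

/-- The standard dyadic subinterval of `[a,b]` of level `p.1` and index `p.2`,
namely `[a + (b-a)·k·2^{-j}, a + (b-a)·(k+1)·2^{-j}]` for `p = (j,k)`. -/
def dInt (a b : ℝ) (p : ℕ × ℕ) : Set ℝ :=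
  Set.Icc (a + (b - a) * p.2 / 2 ^ p.1) (a + (b - a) * (p.2 + 1) / 2 ^ p.1)

/-- The length `(b-a)·2^{-j}` of a standard dyadic subinterval of level `p.1`. -/
noncomputable def dLen (a b : ℝ) (p : ℕ × ℕ) : ℝ := (b - a) / 2 ^ p.1

/-- The parent `(j-1, k/2)` of the dyadic interval indexed by `p = (j,k)`. -/
def dParent (p : ℕ × ℕ) : ℕ × ℕ := (p.1 - 1, p.2 / 2)

/-- A dyadic partition of `[a,b]`: a finite collection of standard dyadic
subintervals (encoded by their level/index pairs) with pairwise disjoint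
interiors, whose union is `[a,b]`. -/
structure DyadicPartition (a b : ℝ) where
  ps : Finset (ℕ × ℕ)
  valid : ∀ p ∈ ps, p.2 < 2 ^ p.1
  cover : (⋃ p ∈ ps, dInt a b p) = Set.Icc a b
  disj : ∀ p ∈ ps, ∀ q ∈ ps, p ≠ q →
    interior (dInt a b p) ∩ interior (dInt a b q) = ∅

/-- The dyadic grid associated with a dyadic partition: the set of endpoints of
its intervals. -/
def dGridSet {a b : ℝ} (P : DyadicPartition a b) : Set ℝ :=
  ⋃ p ∈ P.ps, ({a + (b - a) * p.2 / 2 ^ p.1, a + (b - a) * (p.2 + 1) / 2 ^ p.1} : Set ℝ)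

/-- A grid on `[a,b]`: a finite strictly increasing sequence
`a = x 0 < x 1 < ⋯ < x M = b`. -/
structure Grid (a b : ℝ) where
  M : ℕ
  M_pos : 0 < M
  x : ℕ → ℝ
  mono : StrictMonoOn x (Set.Iic M)
  left : x 0 = a
  right : x M = b

/-- The `i`-th interval `[x i, x (i+1)]` of the partition induced by a grid. -/
def Grid.interval {a b : ℝ} (G : Grid a b) (i : ℕ) : Set ℝ :=
  Set.Icc (G.x i) (G.x (i + 1))

/-- `m(I,G)`: the minimum length of a grid interval of `G` intersecting `I`. -/
noncomputable def Grid.gmin {a b : ℝ} (G : Grid a b) (I : Set ℝ) : ℝ :=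
  sInf {d : ℝ | ∃ i < G.M, (G.interval i ∩ I).Nonempty ∧ d = G.x (i + 1) - G.x i}

/-- `P` is an α-output of the algorithm `DyadicGrid(G, P₀, α)`:
(a) every interval of `P` is contained in some interval of `P₀`;
(b) every interval `D` of `P` satisfies `|D| ≤ α·m(D,G)`;
(c) every interval `D` of `P` not in `P₀` has a parent `D̂` with
    `|D̂| > α·m(D̂,G)`. -/
def IsAlphaOutput {a b : ℝ} (G : Grid a b) (P₀ P : DyadicPartition a b)
    (α : ℝ) : Prop :=
  (∀ p ∈ P.ps, ∃ q ∈ P₀.ps, dInt a b p ⊆ dInt a b q) ∧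
  (∀ p ∈ P.ps, dLen a b p ≤ α * G.gmin (dInt a b p)) ∧
  (∀ p ∈ P.ps, p ∉ P₀.ps →
    1 ≤ p.1 ∧ dLen a b (dParent p) > α * G.gmin (dInt a b (dParent p)))

/-- A grid is symmetric if `x i + x (M-i) = a + b` for all `0 ≤ i ≤ M`. -/
def Grid.Symmetric {a b : ℝ} (G : Grid a b) : Prop :=
  ∀ i ≤ G.M, G.x i + G.x (G.M - i) = a + b

/-- A grid is monotonic if for any two neighboring intervals contained in the
left half `[a, (a+b)/2]`, the left one is at most as long as the right one. -/
def Grid.Monotonic {a b : ℝ} (G : Grid a b) : Prop :=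
  ∀ i : ℕ, i + 1 < G.M →
    G.interval i ∪ G.interval (i + 1) ⊆ Set.Icc a ((a + b) / 2) →
    G.x (i + 1) - G.x i ≤ G.x (i + 2) - G.x (i + 1)

/-- A grid is locally quasi-uniform with constant `C` if any two intersecting
intervals of its induced partition have length ratio between `C⁻¹` and `C`. -/
def Grid.QuasiUniform {a b : ℝ} (G : Grid a b) (C : ℝ) : Prop :=
  ∀ i < G.M, ∀ j < G.M, (G.interval i ∩ G.interval j).Nonempty →
    C⁻¹ ≤ (G.x (i + 1) - G.x i) / (G.x (j + 1) - G.x j) ∧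
    (G.x (i + 1) - G.x i) / (G.x (j + 1) - G.x j) ≤ C

/-- The dyadic grid associated with `P` is symmetric (around the midpoint of
`[a,b]`). -/
def DyadicPartition.SymmetricGrid {a b : ℝ} (P : DyadicPartition a b) : Prop :=
  ∀ x ∈ dGridSet P, a + b - x ∈ dGridSet P

/-- The partition `P` is monotonic: for any two of its intervals contained in
the left half `[a, (a+b)/2]`, with the second the right neighbor of the first,
the left one is at most as long as the right one. -/
def DyadicPartition.Monotonic {a b : ℝ} (P : DyadicPartition a b) : Prop :=
  ∀ p ∈ P.ps, ∀ q ∈ P.ps,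
    dInt a b p ∪ dInt a b q ⊆ Set.Icc a ((a + b) / 2) →
    a + (b - a) * (p.2 + 1) / 2 ^ p.1 = a + (b - a) * q.2 / 2 ^ q.1 →
    dLen a b p ≤ dLen a b q

/-- A dyadic partition is locally quasi-uniform with constant `C` if any two of
its intersecting intervals have length ratio between `C⁻¹` and `C`. -/
def DyadicPartition.QuasiUniform {a b : ℝ} (P : DyadicPartition a b) (C : ℝ) : Prop :=
  ∀ p ∈ P.ps, ∀ q ∈ P.ps, (dInt a b p ∩ dInt a b q).Nonempty →
    C⁻¹ ≤ dLen a b p / dLen a b q ∧ dLen a b p / dLen a b q ≤ C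

/-! ### The Legendre equation and the spacing of the LGL nodes -/

section LGL

open Polynomial

/-- The equation obtained by differentiating `(X² - 1) u' = 2 N X u` a further `k + 1` times,
where `u = (X² - 1) ^ N`. -/
theorem iterate_derivative_X_sq_sub_one_pow (N k : ℕ) :
    ((X : ℝ[X]) ^ 2 - 1) * derivative^[k + 2] ((X ^ 2 - 1) ^ N)
      + 2 * ((k : ℝ[X]) + 1) * X * derivative^[k + 1] ((X ^ 2 - 1) ^ N)
      + ((k : ℝ[X]) + 1) * (k : ℝ[X]) * derivative^[k] ((X ^ 2 - 1) ^ N)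
      = 2 * (N : ℝ[X]) * (X * derivative^[k + 1] ((X ^ 2 - 1) ^ N)
        + ((k : ℝ[X]) + 1) * derivative^[k] ((X ^ 2 - 1) ^ N)) := by
  induction k with
  | zero =>
    have h : ((X : ℝ[X]) ^ 2 - 1) * derivative ((X ^ 2 - 1) ^ N)
        = 2 * (N : ℝ[X]) * X * (X ^ 2 - 1) ^ N := by
      cases N with
      | zero => simp
      | succ n =>
        simp only [derivative_pow, derivative_sub, derivative_X, derivative_one,
          Nat.add_sub_cancel, map_natCast]
        push_cast
        ring
    have h' := congrArg derivative h
    simp only [derivative_mul, derivative_sub, derivative_X_pow, derivative_X, derivative_one,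
      derivative_natCast, derivative_ofNat, C_ofNat, Nat.cast_ofNat] at h'
    simp only [Function.iterate_succ', Function.iterate_zero, Function.comp_apply, id_eq,
      Nat.cast_zero]
    linear_combination h'
  | succ k ih =>
    have h' := congrArg derivative ih
    simp only [derivative_mul, derivative_sub, derivative_add, derivative_X_pow, derivative_X,
      derivative_one, derivative_natCast, derivative_ofNat, C_ofNat, Nat.cast_ofNat,
      ← Function.iterate_succ_apply' (f := derivative)] at h'
    push_cast
    linear_combination h'

theorem derivative_lglPoly (N : ℕ) :
    derivative (lglPoly N) = -((N : ℝ[X]) * (N + 1)) * legendrePoly N := by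
  have h := iterate_derivative_X_sq_sub_one_pow N N
  simp only [Function.iterate_succ_apply'] at h
  unfold lglPoly legendrePoly
  simp only [derivative_mul, derivative_sub, derivative_X_pow, derivative_one, derivative_C,
    C_ofNat, Nat.cast_ofNat, zero_mul, zero_add]
  linear_combination (-C (1 / (2 ^ N * N.factorial : ℝ))) * h

theorem one_sub_sq_mul_eval_derivative_derivative_lglPoly (N : ℕ) (x : ℝ) :
    (1 - x ^ 2) * (derivative (derivative (lglPoly N))).eval x
      = -((N : ℝ) * (N + 1)) * (lglPoly N).eval x := by
  rw [derivative_lglPoly]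
  simp [lglPoly, derivative_mul]
  ring

/-- Sturm-type comparison by Rolle's theorem: if `g` and `v` vanish at `a` and `b`, then the
derivative `g'' v - g v''` of their Wronskian vanishes somewhere in between. -/
theorem exists_wronskian_deriv_eq_zero {g g' g'' v v' v'' : ℝ → ℝ} {a b : ℝ} (hab : a < b)
    (hg : ∀ x, HasDerivAt g (g' x) x) (hg' : ∀ x, HasDerivAt g' (g'' x) x)
    (hv : ∀ x, HasDerivAt v (v' x) x) (hv' : ∀ x, HasDerivAt v' (v'' x) x)
    (hga : g a = 0) (hgb : g b = 0) (hva : v a = 0) (hvb : v b = 0) :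
    ∃ x ∈ Set.Ioo a b, g'' x * v x = g x * v'' x := by
  have hW : ∀ x, HasDerivAt (fun x => g' x * v x - g x * v' x)
      (g'' x * v x - g x * v'' x) x := fun x =>
    (((hg' x).mul (hv x)).sub ((hg x).mul (hv' x))).congr_deriv (by ring)
  obtain ⟨x, hx, h⟩ := exists_hasDerivAt_eq_zero hab
    (fun x _ => (hW x).continuousAt.continuousWithinAt) (by simp [hga, hgb, hva, hvb])
    (fun x _ => hW x)
  exact ⟨x, hx, by linarith⟩

/-- The comparison of `lglPoly N` between two consecutive zeros with a test function `v`. -/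
theorem exists_lglPoly_comparison {N : ℕ} {v v' v'' : ℝ → ℝ} {a b : ℝ} (hab : a < b)
    (hv : ∀ x, HasDerivAt v (v' x) x) (hv' : ∀ x, HasDerivAt v' (v'' x) x)
    (ha : (lglPoly N).eval a = 0) (hb : (lglPoly N).eval b = 0)
    (hne : ∀ x ∈ Set.Ioo a b, (lglPoly N).eval x ≠ 0) (hva : v a = 0) (hvb : v b = 0) :
    ∃ x ∈ Set.Ioo a b, (N : ℝ) * (N + 1) * v x = -(1 - x ^ 2) * v'' x := by
  obtain ⟨x, hx, h⟩ := exists_wronskian_deriv_eq_zero hab (fun x => (lglPoly N).hasDerivAt x)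
    (fun x => (derivative (lglPoly N)).hasDerivAt x) hv hv' ha hb hva hvb
  refine ⟨x, hx, mul_left_cancel₀ (hne x hx) ?_⟩
  linear_combination (-(1 - x ^ 2)) * h
    + v x * one_sub_sq_mul_eval_derivative_derivative_lglPoly N x

theorem exists_lglPoly_gap_sq_eq {N : ℕ} {a b : ℝ} (hab : a < b)
    (ha : (lglPoly N).eval a = 0) (hb : (lglPoly N).eval b = 0)
    (hne : ∀ x ∈ Set.Ioo a b, (lglPoly N).eval x ≠ 0) :
    ∃ x ∈ Set.Ioo a b, (N : ℝ) * (N + 1) * (b - a) ^ 2 = Real.pi ^ 2 * (1 - x ^ 2) := by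
  have hh : 0 < b - a := sub_pos.2 hab
  set κ : ℝ := Real.pi / (b - a) with hκ
  have hκb : κ * (b - a) = Real.pi := by rw [hκ]; field_simp
  have hκ0 : 0 < κ := div_pos Real.pi_pos hh
  have hlin : ∀ x, HasDerivAt (fun x => κ * (x - a)) κ x := fun x => by
    simpa using ((hasDerivAt_id x).sub_const a).const_mul κ
  obtain ⟨x, hx, h⟩ := exists_lglPoly_comparison (v := fun x => Real.sin (κ * (x - a)))
    (v' := fun x => Real.cos (κ * (x - a)) * κ)
    (v'' := fun x => -Real.sin (κ * (x - a)) * κ * κ) hab (fun x => (hlin x).sin)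
    (fun x => ((hlin x).cos).mul_const κ) ha hb hne (by simp) (by simp [hκb])
  refine ⟨x, hx, ?_⟩
  have hs : 0 < Real.sin (κ * (x - a)) :=
    Real.sin_pos_of_pos_of_lt_pi (mul_pos hκ0 (sub_pos.2 hx.1))
      (hκb ▸ mul_lt_mul_of_pos_left (by linarith [hx.2]) hκ0)
  have h1 : (N : ℝ) * (N + 1) = (1 - x ^ 2) * κ ^ 2 :=
    mul_right_cancel₀ hs.ne' (by linear_combination h)
  rw [h1, ← hκb]
  ring

theorem two_le_mul_lglPoly_gap {N : ℕ} {a b : ℝ} (hab : a < b) (ha1 : -1 ≤ a) (hb1 : b ≤ 1)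
    (ha : (lglPoly N).eval a = 0) (hb : (lglPoly N).eval b = 0)
    (hne : ∀ x ∈ Set.Ioo a b, (lglPoly N).eval x ≠ 0) :
    2 ≤ (N : ℝ) * (N + 1) * (b - a) := by
  obtain ⟨x, ⟨hxa, hxb⟩, h⟩ := exists_lglPoly_comparison (v := fun x => (x - a) * (b - x))
    (v' := fun x => a + b - 2 * x) (v'' := fun _ => -2) hab
    (fun x => (((hasDerivAt_id' x).sub_const a).mul ((hasDerivAt_id' x).const_sub b)).congr_deriv
      (by ring))
    (fun x => (((hasDerivAt_id' x).const_mul 2).const_sub (a + b)).congr_deriv (by ring))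
    ha hb hne (by simp) (by simp)
  have hK : 0 ≤ (N : ℝ) * (N + 1) := by positivity
  rcases le_total x 0 with hx | hx
  · have h1 : 2 * (1 - x) * (1 + x) ≤ (N : ℝ) * (N + 1) * (b - x) * (1 + x) := by
      nlinarith [mul_le_mul_of_nonneg_left (show x - a ≤ 1 + x by linarith)
        (mul_nonneg hK (sub_nonneg.2 hxb.le))]
    have h2 := le_of_mul_le_mul_right h1 (by linarith)
    nlinarith [mul_le_mul_of_nonneg_left (show b - x ≤ b - a by linarith) hK]
  · have h1 : 2 * (1 + x) * (1 - x) ≤ (N : ℝ) * (N + 1) * (x - a) * (1 - x) := by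
      nlinarith [mul_le_mul_of_nonneg_left (show b - x ≤ 1 - x by linarith)
        (mul_nonneg hK (sub_nonneg.2 hxa.le))]
    have h2 := le_of_mul_le_mul_right h1 (by linarith)
    nlinarith [mul_le_mul_of_nonneg_left (show x - a ≤ b - a by linarith) hK]

end LGL

/-- The local mesh size `√(1 - |x|) / M + 1 / M²` of the LGL grid of order `M` at `x`. -/
noncomputable def meshSize (M x : ℝ) : ℝ := √(1 - |x|) / M + 1 / M ^ 2

theorem meshSize_pos {M : ℝ} (hM : 0 < M) (x : ℝ) : 0 < meshSize M x := by
  unfold meshSize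
  positivity

theorem meshSize_anti {M N : ℝ} (hM : 0 < M) (h : M ≤ N) (x : ℝ) :
    meshSize N x ≤ meshSize M x := by
  unfold meshSize
  gcongr

theorem meshSize_le_four_mul {M N : ℝ} (hM : 0 < M) (h : M ≤ N) (h' : N ≤ 2 * M) (x : ℝ) :
    meshSize M x ≤ 4 * meshSize N x := by
  have hN : 0 < N := hM.trans_le h
  have h1 : 1 / M ≤ 2 * (1 / N) := by
    rw [mul_one_div, div_le_div_iff₀ hM hN]
    linarith
  have h0 : 0 < 1 / M := by positivity
  have hN0 : 0 < 1 / N := by positivity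
  have h2 : (1 / M) ^ 2 ≤ 4 * (1 / N) ^ 2 := by nlinarith
  have hs := Real.sqrt_nonneg (1 - |x|)
  have e : ∀ R : ℝ, meshSize R x = √(1 - |x|) * (1 / R) + (1 / R) ^ 2 := fun R => by
    unfold meshSize
    ring
  rw [e, e]
  nlinarith [mul_le_mul_of_nonneg_left h1 hs, mul_nonneg hs hN0.le]

/-- The gaps of the LGL grid are comparable to the local mesh size. -/
theorem IsLGLNodes.gap_bounds {N : ℕ} (hN : 1 ≤ N) {ξ : ℕ → ℝ} (hξ : IsLGLNodes N ξ) {i : ℕ}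
    (hi : i < N) {x : ℝ} (hx : x ∈ Set.Icc (ξ i) (ξ (i + 1))) :
    meshSize N x ≤ 3 * (ξ (i + 1) - ξ i) ∧ ξ (i + 1) - ξ i ≤ 20 * meshSize N x := by
  obtain ⟨hmono, h0, h1, hz, hall⟩ := hξ
  have hiN : i ∈ Set.Iic N := hi.le
  have hiN' : i + 1 ∈ Set.Iic N := hi
  have hab : ξ i < ξ (i + 1) := hmono hiN hiN' (Nat.lt_succ_self i)
  have ha1 : -1 ≤ ξ i := h0 ▸ hmono.monotoneOn (Nat.zero_le N) hiN (Nat.zero_le i)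
  have hb1 : ξ (i + 1) ≤ 1 := h1 ▸ hmono.monotoneOn hiN' (le_refl N) hi
  have hne : ∀ y ∈ Set.Ioo (ξ i) (ξ (i + 1)), (lglPoly N).eval y ≠ 0 := by
    rintro y ⟨hy1, hy2⟩ hy
    obtain ⟨k, hk, rfl⟩ := hall y hy
    have := (hmono.lt_iff_lt hiN hk).1 hy1
    have := (hmono.lt_iff_lt hk hiN').1 hy2
    omega
  obtain ⟨x₀, hx₀, hgap⟩ := exists_lglPoly_gap_sq_eq hab (hz i hiN) (hz _ hiN') hne
  have hlow := two_le_mul_lglPoly_gap hab ha1 hb1 (hz i hiN) (hz _ hiN') hne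
  set h := ξ (i + 1) - ξ i with hh
  have hh0 : 0 < h := sub_pos.2 hab
  have hN1 : (1 : ℝ) ≤ N := by exact_mod_cast hN
  have hdist : |(|x| - |x₀|)| ≤ h := (abs_abs_sub_abs_le_abs_sub x x₀).trans
    (abs_le.2 ⟨by linarith [hx.1, hx₀.2], by linarith [hx.2, hx₀.1]⟩)
  rw [abs_le] at hdist
  have habs : |x| ≤ 1 := abs_le.2 ⟨by linarith [hx.1], by linarith [hx.2]⟩
  have habs₀ : |x₀| ≤ 1 := abs_le.2 ⟨by linarith [hx₀.1], by linarith [hx₀.2]⟩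
  have hfac : 1 - x₀ ^ 2 = (1 - |x₀|) * (1 + |x₀|) := by
    rw [← sq_abs]
    ring
  have hpi1 := Real.pi_gt_three
  have hpi2 : Real.pi ^ 2 ≤ 10 := by nlinarith [Real.pi_lt_d2, Real.pi_pos]
  have hpi3 : 9 ≤ Real.pi ^ 2 := by nlinarith
  have hq1 : 1 - |x₀| ≤ 1 - x₀ ^ 2 := by
    rw [hfac]
    nlinarith [abs_nonneg x₀]
  have hq2 : 1 - x₀ ^ 2 ≤ 2 * (1 - |x₀|) := by
    rw [hfac]
    nlinarith [abs_nonneg x₀]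
  have hup : (N * h) ^ 2 ≤ 20 * (1 - |x| + h) := by
    have : (N * h) ^ 2 ≤ (N : ℝ) * (N + 1) * h ^ 2 := by nlinarith [sq_nonneg h]
    nlinarith
  have hdn : 9 * (1 - |x| - h) ≤ 2 * (N * h) ^ 2 := by
    have : (N : ℝ) * (N + 1) * h ^ 2 ≤ 2 * (N * h) ^ 2 := by
      nlinarith [mul_nonneg (mul_nonneg (sub_nonneg.2 hN1) (zero_le_one.trans hN1)) (sq_nonneg h)]
    nlinarith
  have hlow' : 1 ≤ (N : ℝ) ^ 2 * h := by
    nlinarith [mul_nonneg (mul_nonneg (sub_nonneg.2 hN1) (zero_le_one.trans hN1)) hh0.le]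
  have hNpos : (0 : ℝ) < N := by linarith
  set σ := √(1 - |x|) with hσ
  have hσ0 : 0 ≤ σ := Real.sqrt_nonneg _
  have hσ2 : σ ^ 2 = 1 - |x| := Real.sq_sqrt (by linarith)
  have hmesh : meshSize N x = (σ * N + 1) / (N : ℝ) ^ 2 := by
    unfold meshSize
    rw [← hσ]
    field_simp
  rw [hmesh]
  constructor
  · rw [div_le_iff₀ (by positivity)]
    have h1 : σ ≤ 2 * (N * h) := by
      refine le_of_sq_le_sq ?_ (by positivity)
      nlinarith
    nlinarith
  · rw [mul_div_assoc', le_div_iff₀ (by positivity)]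
    by_contra! hcon
    have h1 : 20 * σ ≤ N * h := by
      refine le_of_mul_le_mul_right ?_ hNpos
      linarith
    have h2 := mul_lt_mul_of_pos_right hcon hh0
    have h3 := mul_le_mul_of_nonneg_left h1 hσ0
    have h4 : (N * h) ^ 2 = h * N ^ 2 * h := by ring
    rw [← hσ2] at hup
    have h5 : 20 * (σ * N + 1) * h = 20 * (σ * (N * h)) + 20 * h := by ring
    have h6 : σ * (20 * σ) = 20 * σ ^ 2 := by ring
    linarith [sq_nonneg σ]

/-! ### The dyadic partitions

For scale `m`, the interval `[-1, 1]` is divided into `2 * 4 ^ m` unit cells of length `4 ^ (-m)`,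
and the unit cell `n` is merged into a dyadic interval made of `2 ^ lglLevel m n` unit cells. -/

/-- The level of merging at the unit cell `n`: the logarithm in base `4` of the distance of the
cell to the boundary. -/
def lglLevel (m n : ℕ) : ℕ := Nat.log 4 (min n (2 * 4 ^ m - 1 - n))

/-- The index of the dyadic interval into which the unit cell `n` is merged. -/
def lglCell (m n : ℕ) : ℕ × ℕ := (2 * m + 1 - lglLevel m n, n / 2 ^ lglLevel m n)

theorem lglLevel_reflect {m n : ℕ} (hn : n < 2 * 4 ^ m) :
    lglLevel m (2 * 4 ^ m - 1 - n) = lglLevel m n := by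
  unfold lglLevel
  congr 1
  omega

theorem lglLevel_le {m n : ℕ} (hn : n < 2 * 4 ^ m) : lglLevel m n ≤ m := by
  have h : min n (2 * 4 ^ m - 1 - n) < 4 ^ m := by omega
  exact Nat.lt_succ_iff.1 (Nat.log_lt_of_lt_pow' (by omega) (h.trans_le (by gcongr <;> omega)))

theorem four_pow_eq_two_pow_mul (i : ℕ) : 4 ^ i = 2 ^ i * 2 ^ i := by
  rw [← mul_pow]
  norm_num

theorem two_pow_dvd_four_pow {i j : ℕ} (h : i ≤ j) : 2 ^ i ∣ 4 ^ j := by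
  rw [four_pow_eq_two_pow_mul]
  exact (pow_dvd_pow 2 h).mul_right _

theorem two_pow_dvd_total {m i : ℕ} (h : i ≤ m) : 2 ^ i ∣ 2 * 4 ^ m :=
  (two_pow_dvd_four_pow h).mul_left 2

theorem le_iff_le_of_div_eq {n n' d s : ℕ} (hd : 0 < d) (h : n' / d = n / d) (hs : d ∣ s) :
    s ≤ n' ↔ s ≤ n := by
  obtain ⟨c, rfl⟩ := hs
  rw [mul_comm, ← Nat.le_div_iff_mul_le hd, ← Nat.le_div_iff_mul_le hd, h]

/-- The level is constant on the unit cells merged into one interval. -/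
theorem lglLevel_eq_of_div_eq {m n n' : ℕ} (hn : n < 2 * 4 ^ m)
    (h : n' / 2 ^ lglLevel m n = n / 2 ^ lglLevel m n) : lglLevel m n' = lglLevel m n := by
  have him := lglLevel_le hn
  set i := lglLevel m n with hi
  rcases Nat.eq_zero_or_pos i with h0 | h0
  · rw [h0, pow_zero, Nat.div_one, Nat.div_one] at h
    rw [h]
  · obtain ⟨h1, h2⟩ := (Nat.log_eq_iff (Or.inl h0.ne')).1 hi.symm
    have hd : 0 < 2 ^ i := by positivity
    have e1 := le_iff_le_of_div_eq hd h (two_pow_dvd_four_pow le_rfl)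
    have e2 := le_iff_le_of_div_eq hd h (two_pow_dvd_four_pow (Nat.le_succ i))
    have e3 := le_iff_le_of_div_eq hd h (two_pow_dvd_total him)
    have e4 := le_iff_le_of_div_eq hd h
      (Nat.dvd_sub (two_pow_dvd_total him) (two_pow_dvd_four_pow (le_refl i)))
    have e5 := le_iff_le_of_div_eq hd h
      (Nat.dvd_sub (two_pow_dvd_total him) (two_pow_dvd_four_pow (Nat.le_succ i)))
    exact (Nat.log_eq_iff (Or.inl h0.ne')).2 (by omega)

theorem lglCell_eq_of_div_eq {m n n' : ℕ} (hn : n < 2 * 4 ^ m)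
    (h : n' / 2 ^ lglLevel m n = n / 2 ^ lglLevel m n) : lglCell m n' = lglCell m n := by
  rw [lglCell, lglLevel_eq_of_div_eq hn h, h, lglCell]

theorem endpoint_eq {m i : ℕ} (hi : i ≤ m) (t : ℝ) :
    -1 + (1 - -1) * t / 2 ^ (2 * m + 1 - i) = -1 + 2 ^ i * t / 4 ^ m := by
  have h : (2 : ℝ) ^ i * 2 ^ (2 * m + 1 - i) = 2 * 4 ^ m := by
    rw [← pow_add, show i + (2 * m + 1 - i) = 2 * m + 1 by omega, pow_succ, pow_mul]
    norm_num
    ring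
  have h1 : (0 : ℝ) < 2 ^ (2 * m + 1 - i) := by positivity
  have h2 : (0 : ℝ) < 4 ^ m := by positivity
  congr 1
  rw [div_eq_div_iff h1.ne' h2.ne']
  linear_combination (-t) * h

theorem dLen_lglCell {m n : ℕ} (hn : n < 2 * 4 ^ m) :
    dLen (-1) 1 (lglCell m n) = 2 ^ lglLevel m n / 4 ^ m := by
  have h := endpoint_eq (lglLevel_le hn) 1
  rw [mul_one, mul_one] at h
  exact add_left_cancel h

theorem dInt_lglCell {m n : ℕ} (hn : n < 2 * 4 ^ m) :
    dInt (-1) 1 (lglCell m n) =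
      Set.Icc (-1 + 2 ^ lglLevel m n * ((n / 2 ^ lglLevel m n : ℕ) : ℝ) / 4 ^ m)
        (-1 + 2 ^ lglLevel m n * (((n / 2 ^ lglLevel m n : ℕ) : ℝ) + 1) / 4 ^ m) := by
  unfold dInt lglCell
  rw [endpoint_eq (lglLevel_le hn), endpoint_eq (lglLevel_le hn)]

theorem neg_one_add_div_le_iff {m : ℕ} {t x : ℝ} : -1 + t / 4 ^ m ≤ x ↔ t ≤ (x + 1) * 4 ^ m := by
  rw [← div_le_iff₀ (by positivity)]
  constructor <;> intro h <;> linarith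

theorem le_neg_one_add_div_iff {m : ℕ} {t x : ℝ} : x ≤ -1 + t / 4 ^ m ↔ (x + 1) * 4 ^ m ≤ t := by
  rw [← le_div_iff₀ (by positivity)]
  constructor <;> intro h <;> linarith

theorem div_eq_of_mem_interior_lglCell {m n : ℕ} (hn : n < 2 * 4 ^ m) {x : ℝ}
    (hx : x ∈ interior (dInt (-1) 1 (lglCell m n))) :
    ⌊(x + 1) * 4 ^ m⌋₊ / 2 ^ lglLevel m n = n / 2 ^ lglLevel m n := by
  rw [dInt_lglCell hn, interior_Icc] at hx
  obtain ⟨h1, h2⟩ := hx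
  rw [← not_le, le_neg_one_add_div_iff, not_le] at h1
  rw [← not_le, neg_one_add_div_le_iff, not_le] at h2
  have hd : 0 < 2 ^ lglLevel m n := by positivity
  have hy : 0 ≤ (x + 1) * 4 ^ m := le_trans (by positivity) h1.le
  rw [Nat.div_eq_iff hd]
  have h3 : n / 2 ^ lglLevel m n * 2 ^ lglLevel m n ≤ ⌊(x + 1) * 4 ^ m⌋₊ := by
    apply Nat.le_floor
    push_cast
    linarith
  have h4 : ⌊(x + 1) * 4 ^ m⌋₊ < 2 ^ lglLevel m n * (n / 2 ^ lglLevel m n + 1) := by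
    rw [Nat.floor_lt hy]
    push_cast
    exact h2
  constructor
  · exact h3
  · rw [mul_add, mul_one, mul_comm (2 ^ lglLevel m n)] at h4
    omega

theorem mem_dInt_lglCell_of_mem_unit {m n : ℕ} (hn : n < 2 * 4 ^ m) {x : ℝ}
    (h1 : (n : ℝ) ≤ (x + 1) * 4 ^ m) (h2 : (x + 1) * 4 ^ m ≤ n + 1) :
    x ∈ dInt (-1) 1 (lglCell m n) := by
  rw [dInt_lglCell hn, Set.mem_Icc, neg_one_add_div_le_iff, le_neg_one_add_div_iff]
  have h3 := Nat.mul_div_le n (2 ^ lglLevel m n)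
  have h4 : n + 1 ≤ 2 ^ lglLevel m n * (n / 2 ^ lglLevel m n + 1) :=
    Nat.lt_mul_div_succ n (by positivity)
  have h3' : (2 : ℝ) ^ lglLevel m n * ((n / 2 ^ lglLevel m n : ℕ) : ℝ) ≤ n := by exact_mod_cast h3
  have h4' : (n : ℝ) + 1 ≤ 2 ^ lglLevel m n * (((n / 2 ^ lglLevel m n : ℕ) : ℝ) + 1) := by
    exact_mod_cast h4
  exact ⟨h3'.trans h1, h2.trans h4'⟩

theorem lglCell_snd_lt {m n : ℕ} (hn : n < 2 * 4 ^ m) :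
    n / 2 ^ lglLevel m n < 2 ^ (2 * m + 1 - lglLevel m n) := by
  rw [Nat.div_lt_iff_lt_mul (by positivity), ← pow_add,
    Nat.sub_add_cancel (by have := lglLevel_le hn; omega), pow_succ, pow_mul,
    mul_comm]
  exact hn

/-- The dyadic partition of `[-1, 1]` at scale `m`, adapted to the LGL grids of order about
`2 ^ m`. -/
def lglPartition (m : ℕ) : DyadicPartition (-1 : ℝ) 1 where
  ps := (Finset.range (2 * 4 ^ m)).image (lglCell m)
  valid := by
    intro p hp
    obtain ⟨n, hn, rfl⟩ := Finset.mem_image.1 hp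
    exact lglCell_snd_lt (Finset.mem_range.1 hn)
  cover := by
    have h4 : (0 : ℝ) < 4 ^ m := by positivity
    ext x
    simp only [Set.mem_iUnion, exists_prop, Finset.mem_image, Finset.mem_range]
    constructor
    · rintro ⟨_, ⟨n, hn, rfl⟩, hx⟩
      rw [dInt_lglCell hn, Set.mem_Icc, le_neg_one_add_div_iff, neg_one_add_div_le_iff] at hx
      have h := lglCell_snd_lt hn
      have h1 : 2 ^ lglLevel m n * (n / 2 ^ lglLevel m n + 1) ≤ 2 * 4 ^ m := by
        calc _ ≤ 2 ^ lglLevel m n * 2 ^ (2 * m + 1 - lglLevel m n) := by gcongr; omega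
          _ = 2 * 4 ^ m := by
            rw [← pow_add, Nat.add_sub_cancel' (by have := lglLevel_le hn; omega), pow_succ,
              pow_mul, mul_comm]
            norm_num
      have h2 : (2 : ℝ) ^ lglLevel m n * (((n / 2 ^ lglLevel m n : ℕ) : ℝ) + 1) ≤ 2 * 4 ^ m := by
        exact_mod_cast h1
      have h3 : 0 ≤ (x + 1) * 4 ^ m := le_trans (by positivity) hx.1
      have h5 : (x + 1) * 4 ^ m ≤ 2 * 4 ^ m := hx.2.trans h2
      exact ⟨by linarith [nonneg_of_mul_nonneg_left h3 h4], by
        linarith [le_of_mul_le_mul_right h5 h4]⟩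
    · rintro ⟨hx1, hx2⟩
      rcases hx2.eq_or_lt with rfl | hx2
      · have hT : 0 < 2 * 4 ^ m := by positivity
        refine ⟨_, ⟨2 * 4 ^ m - 1, by omega, rfl⟩, mem_dInt_lglCell_of_mem_unit (by omega) ?_ ?_⟩
        all_goals
          rw [Nat.cast_pred hT]
          push_cast
          linarith
      · have hy : 0 ≤ (x + 1) * 4 ^ m := mul_nonneg (by linarith) h4.le
        have hn : ⌊(x + 1) * 4 ^ m⌋₊ < 2 * 4 ^ m := by
          rw [Nat.floor_lt hy]
          push_cast
          exact mul_lt_mul_of_pos_right (by linarith) h4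
        exact ⟨_, ⟨_, hn, rfl⟩, mem_dInt_lglCell_of_mem_unit hn (Nat.floor_le hy)
          (Nat.lt_floor_add_one _).le⟩
  disj := by
    intro p hp q hq hpq
    obtain ⟨n, hn, rfl⟩ := Finset.mem_image.1 hp
    obtain ⟨n', hn', rfl⟩ := Finset.mem_image.1 hq
    rw [Finset.mem_range] at hn hn'
    rw [Set.eq_empty_iff_forall_notMem]
    rintro x ⟨hx, hx'⟩
    exact hpq ((lglCell_eq_of_div_eq hn (div_eq_of_mem_interior_lglCell hn hx)).symm.trans
      (lglCell_eq_of_div_eq hn' (div_eq_of_mem_interior_lglCell hn' hx')))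

theorem mem_lglPartition {m : ℕ} {p : ℕ × ℕ} :
    p ∈ (lglPartition m).ps ↔ ∃ n < 2 * 4 ^ m, lglCell m n = p := by
  simp [lglPartition]

/-- The interval of the unit cell `w` ends at `w + 1` if and only if the interval of the unit cell
`w + 1` starts there. -/
theorem two_pow_lglLevel_dvd_succ_iff {m w : ℕ} (hw : w + 1 < 2 * 4 ^ m) :
    2 ^ lglLevel m w ∣ w + 1 ↔ 2 ^ lglLevel m (w + 1) ∣ w + 1 := by
  have key : ∀ d, ¬ d ∣ w + 1 → (w + 1) / d = w / d := fun d hd => by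
    rw [Nat.succ_div, if_neg hd, add_zero]
  constructor
  · intro h
    by_contra h'
    rw [lglLevel_eq_of_div_eq hw (key _ h').symm] at h
    exact h' h
  · intro h
    by_contra h'
    rw [lglLevel_eq_of_div_eq (by omega) (key _ h')] at h
    exact h' h

theorem lglLevel_mul_div {m n : ℕ} (hn : n < 2 * 4 ^ m) :
    lglLevel m (2 ^ lglLevel m n * (n / 2 ^ lglLevel m n)) = lglLevel m n :=
  lglLevel_eq_of_div_eq hn (Nat.mul_div_cancel_left _ (by positivity))

theorem mem_dGridSet_lglPartition {m : ℕ} {x : ℝ} :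
    x ∈ dGridSet (lglPartition m) ↔
      ∃ v : ℕ, v ≤ 2 * 4 ^ m ∧ (v < 2 * 4 ^ m → 2 ^ lglLevel m v ∣ v) ∧ x = -1 + v / 4 ^ m := by
  simp only [dGridSet, Set.mem_iUnion, exists_prop, mem_lglPartition, Set.mem_insert_iff,
    Set.mem_singleton_iff]
  constructor
  · rintro ⟨_, ⟨n, hn, rfl⟩, h⟩
    simp only [lglCell] at h
    rw [endpoint_eq (lglLevel_le hn), endpoint_eq (lglLevel_le hn)] at h
    rcases h with rfl | rfl
    · refine ⟨2 ^ lglLevel m n * (n / 2 ^ lglLevel m n),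
        (Nat.mul_div_le _ _).trans hn.le, fun _ => ?_, by push_cast; rfl⟩
      rw [lglLevel_mul_div hn]
      exact dvd_mul_right _ _
    · have hd : 0 < 2 ^ lglLevel m n := by positivity
      have hle : 2 ^ lglLevel m n * (n / 2 ^ lglLevel m n + 1) ≤ 2 * 4 ^ m := by
        obtain ⟨c, hc⟩ := two_pow_dvd_total (lglLevel_le hn)
        have : n / 2 ^ lglLevel m n < c := (Nat.div_lt_iff_lt_mul hd).2 (by
          rw [mul_comm, ← hc]
          exact hn)
        rw [hc]
        gcongr
        omega
      refine ⟨2 ^ lglLevel m n * (n / 2 ^ lglLevel m n + 1), hle, fun hlt => ?_, by push_cast; rfl⟩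
      obtain ⟨w, hw⟩ : ∃ w, 2 ^ lglLevel m n * (n / 2 ^ lglLevel m n + 1) = w + 1 :=
        Nat.exists_eq_add_one.2 (by positivity)
      have hwl : lglLevel m w = lglLevel m n := by
        refine lglLevel_eq_of_div_eq hn ?_
        rw [Nat.div_eq_iff hd]
        rw [mul_add, mul_one, mul_comm] at hw
        omega
      have hdvd := Dvd.intro _ hw
      rw [hw] at hlt ⊢
      rw [← hwl] at hdvd
      exact (two_pow_lglLevel_dvd_succ_iff hlt).1 hdvd
  · rintro ⟨v, hv, hdvd, rfl⟩
    rcases hv.eq_or_lt with rfl | hlt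
    · have hT : 0 < 2 * 4 ^ m := by positivity
      have hl : lglLevel m (2 * 4 ^ m - 1) = 0 := by simp [lglLevel]
      refine ⟨_, ⟨2 * 4 ^ m - 1, by omega, rfl⟩, Or.inr ?_⟩
      simp only [lglCell]
      rw [hl, endpoint_eq (Nat.zero_le m), pow_zero, pow_zero, Nat.div_one, Nat.cast_pred hT]
      ring
    · refine ⟨_, ⟨v, hlt, rfl⟩, Or.inl ?_⟩
      simp only [lglCell]
      rw [endpoint_eq (lglLevel_le hlt)]
      have : (2 : ℝ) ^ lglLevel m v * ((v / 2 ^ lglLevel m v : ℕ) : ℝ) = v := by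
        exact_mod_cast Nat.mul_div_cancel' (hdvd hlt)
      rw [this]

theorem lglPartition_symmetricGrid (m : ℕ) : (lglPartition m).SymmetricGrid := by
  intro x hx
  rw [mem_dGridSet_lglPartition] at hx ⊢
  obtain ⟨v, hv, hdvd, rfl⟩ := hx
  refine ⟨2 * 4 ^ m - v, Nat.sub_le _ _, fun hlt => ?_, ?_⟩
  · obtain ⟨w, rfl⟩ : ∃ w, v = w + 1 := Nat.exists_eq_add_one.2 (by omega)
    have hw : w < 2 * 4 ^ m := by omega
    have h1 : 2 ^ lglLevel m w ∣ w + 1 := by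
      rcases hv.eq_or_lt with h | h
      · rw [h]
        exact two_pow_dvd_total (lglLevel_le hw)
      · exact (two_pow_lglLevel_dvd_succ_iff h).2 (hdvd h)
    rw [show 2 * 4 ^ m - (w + 1) = 2 * 4 ^ m - 1 - w by omega, lglLevel_reflect hw,
      show 2 * 4 ^ m - 1 - w = 2 * 4 ^ m - (w + 1) by omega]
    exact Nat.dvd_sub (two_pow_dvd_total (lglLevel_le hw)) h1
  · rw [Nat.cast_sub hv]
    push_cast
    field_simp
    ring

theorem lglPartition_monotonic (m : ℕ) : (lglPartition m).Monotonic := by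
  intro p hp q hq hsub hadj
  obtain ⟨n, hn, rfl⟩ := mem_lglPartition.1 hp
  obtain ⟨n', hn', rfl⟩ := mem_lglPartition.1 hq
  have h4 : (0 : ℝ) < 4 ^ m := by positivity
  simp only [lglCell] at hadj
  rw [endpoint_eq (lglLevel_le hn), endpoint_eq (lglLevel_le hn')] at hadj
  have hadj' : 2 ^ lglLevel m n * (n / 2 ^ lglLevel m n + 1)
      = 2 ^ lglLevel m n' * (n' / 2 ^ lglLevel m n') := by
    have := (div_left_inj' h4.ne').1 (add_left_cancel hadj)
    exact_mod_cast this
  have hlt : n < n' := calc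
    n < 2 ^ lglLevel m n * (n / 2 ^ lglLevel m n + 1) := Nat.lt_mul_div_succ n (by positivity)
    _ ≤ n' := hadj'.trans_le (Nat.mul_div_le _ _)
  have hhalf : n' < 4 ^ m := by
    have hmem : -1 + ((n' : ℝ) + 1) / 4 ^ m ∈ dInt (-1) 1 (lglCell m n') := by
      have : (-1 + ((n' : ℝ) + 1) / 4 ^ m + 1) * 4 ^ m = n' + 1 := by
        field_simp
        ring
      exact mem_dInt_lglCell_of_mem_unit hn' (by rw [this]; linarith) this.le
    have h := (hsub (Or.inr hmem)).2
    have h' : ((n' : ℝ) + 1) / 4 ^ m ≤ 1 := by linarith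
    rw [div_le_one h4] at h'
    exact_mod_cast h'
  rw [dLen_lglCell hn, dLen_lglCell hn']
  have hlev : lglLevel m n ≤ lglLevel m n' := Nat.log_mono_right (by omega)
  gcongr
  norm_num

theorem dGridSet_lglPartition_subset_succ (m : ℕ) :
    dGridSet (lglPartition m) ⊆ dGridSet (lglPartition (m + 1)) := by
  intro x hx
  rw [mem_dGridSet_lglPartition] at hx ⊢
  obtain ⟨v, hv, hdvd, rfl⟩ := hx
  have hT : 2 * 4 ^ (m + 1) = 4 * (2 * 4 ^ m) := by ring
  refine ⟨4 * v, by omega, fun hlt => ?_, ?_⟩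
  · have hlt' : v < 2 * 4 ^ m := by omega
    have hlev : lglLevel (m + 1) (4 * v) ≤ lglLevel m v + 1 := by
      have h1 := Nat.lt_pow_succ_log_self (b := 4) (by norm_num) (min v (2 * 4 ^ m - 1 - v))
      refine Nat.lt_succ_iff.1 (Nat.log_lt_of_lt_pow' (by omega) ?_)
      rw [pow_succ, Nat.succ_eq_add_one]
      change min v (2 * 4 ^ m - 1 - v) < 4 ^ (lglLevel m v + 1) at h1
      omega
    calc 2 ^ lglLevel (m + 1) (4 * v) ∣ 2 ^ (lglLevel m v + 1) := pow_dvd_pow 2 hlev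
      _ = 2 ^ lglLevel m v * 2 := pow_succ _ _
      _ ∣ v * 4 := mul_dvd_mul (hdvd hlt') (by norm_num)
      _ = 4 * v := mul_comm _ _
  · push_cast
    rw [pow_succ]
    field_simp

/-- The intervals of the partition at scale `m` are comparable to the local mesh size of
order `2 ^ m`. -/
theorem dLen_lglPartition_bounds {m : ℕ} {p : ℕ × ℕ} (hp : p ∈ (lglPartition m).ps) {x : ℝ}
    (hx : x ∈ dInt (-1) 1 p) :
    dLen (-1) 1 p ≤ meshSize (2 ^ m) x ∧ meshSize (2 ^ m) x ≤ 3 * dLen (-1) 1 p := by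
  obtain ⟨n, hn, rfl⟩ := mem_lglPartition.1 hp
  have hx1 : x ∈ Set.Icc (-1 : ℝ) 1 := by
    rw [← (lglPartition m).cover]
    exact Set.mem_biUnion hp hx
  rw [dInt_lglCell hn, Set.mem_Icc, le_neg_one_add_div_iff, neg_one_add_div_le_iff] at hx
  rw [dLen_lglCell hn]
  have him := lglLevel_le hn
  have hlog : min n (2 * 4 ^ m - 1 - n) < 4 ^ (lglLevel m n + 1) :=
    Nat.lt_pow_succ_log_self (by norm_num) _
  have hlog' : lglLevel m n ≠ 0 → 4 ^ lglLevel m n ≤ min n (2 * 4 ^ m - 1 - n) := fun h =>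
    ((Nat.log_eq_iff (Or.inl h)).1 rfl).1
  set i := lglLevel m n with hi
  set k := n / 2 ^ i with hk
  obtain ⟨c, hc⟩ : 2 ^ i ∣ 2 * 4 ^ m := two_pow_dvd_total him
  have hd : 0 < 2 ^ i := by positivity
  have hkn : 2 ^ i * k ≤ n := Nat.mul_div_le _ _
  have hnk : n < 2 ^ i * (k + 1) := Nat.lt_mul_div_succ n hd
  have hup : ∀ s, 2 ^ i ∣ s → n < s → 2 ^ i * (k + 1) ≤ s := by
    rintro _ ⟨s, rfl⟩ h
    exact Nat.mul_le_mul_left _ (Nat.succ_le_of_lt (lt_of_mul_lt_mul_left (hkn.trans_lt h)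
      (Nat.zero_le _)))
  have hlo : ∀ s, 2 ^ i ∣ s → s ≤ n → s ≤ 2 ^ i * k := by
    rintro _ ⟨s, rfl⟩ h
    exact Nat.mul_le_mul_left _ (Nat.lt_succ_iff.1 (lt_of_mul_lt_mul_left (h.trans_lt hnk)
      (Nat.zero_le _)))
  have d1 : 2 ^ i ∣ 4 ^ i := two_pow_dvd_four_pow le_rfl
  have d2 : 2 ^ i ∣ 4 ^ (i + 1) := two_pow_dvd_four_pow (Nat.le_succ i)
  have dT : 2 ^ i ∣ 2 * 4 ^ m := two_pow_dvd_total him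
  set y := (x + 1) * 4 ^ m with hy
  have h4 : (0 : ℝ) < 4 ^ m := by positivity
  have e4 : (4 : ℝ) ^ m = (2 ^ m) ^ 2 := by rw [← pow_mul, mul_comm, pow_mul]; norm_num
  have e4i : (4 : ℝ) ^ i = (2 ^ i) ^ 2 := by rw [← pow_mul, mul_comm, pow_mul]; norm_num
  have hdabs : (1 - |x|) * 4 ^ m = min y (2 * 4 ^ m - y) := by
    rw [show 2 * 4 ^ m - y = (1 - x) * 4 ^ m by rw [hy]; ring, hy, ← min_mul_of_nonneg _ _ h4.le]
    congr 1
    rcases abs_cases x with ⟨h, h'⟩ | ⟨h, h'⟩ <;> rw [h]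
    · rw [min_eq_right (by linarith)]
    · rw [min_eq_left (by linarith)]
      ring
  have hA : (1 - |x|) * 4 ^ m ≤ 4 * (2 ^ i) ^ 2 := by
    rw [hdabs, ← e4i, ← pow_succ', min_le_iff]
    rcases min_lt_iff.1 hlog with h | h
    · left
      have := hup _ d2 h
      refine hx.2.trans ?_
      exact_mod_cast this
    · right
      have h' : 2 * 4 ^ m ≤ 2 ^ i * k + 4 ^ (i + 1) := by
        have := hlo _ (Nat.dvd_sub dT d2) (by omega)
        omega
      have h'' : (2 : ℝ) * 4 ^ m ≤ 2 ^ i * k + 4 ^ (i + 1) := by exact_mod_cast h'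
      linarith [hx.1]
  have hB : i ≠ 0 → ((2 : ℝ) ^ i) ^ 2 ≤ (1 - |x|) * 4 ^ m := by
    intro h0
    have h := hlog' h0
    rw [hdabs, ← e4i, le_min_iff]
    have h1 := hlo _ d1 (h.trans (min_le_left _ _))
    have h2 := hup _ (Nat.dvd_sub dT d1) (by omega)
    have h3 : 2 ^ i * (k + 1) + 4 ^ i ≤ 2 * 4 ^ m := by omega
    have h1' : (4 : ℝ) ^ i ≤ 2 ^ i * k := by exact_mod_cast h1
    have h3' : (2 : ℝ) ^ i * (k + 1) + 4 ^ i ≤ 2 * 4 ^ m := by exact_mod_cast h3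
    constructor
    · linarith [hx.1]
    · linarith [hx.2]
  set M : ℝ := 2 ^ m with hM
  have hM0 : 0 < M := by positivity
  set σ := √(1 - |x|) with hσ
  have hσ0 : 0 ≤ σ := Real.sqrt_nonneg _
  have hσ2 : σ ^ 2 = 1 - |x| := Real.sq_sqrt (by linarith [abs_le.2 hx1])
  have hmesh : meshSize M x = (σ * M + 1) / M ^ 2 := by
    unfold meshSize
    rw [← hσ]
    field_simp
  rw [hmesh, e4, mul_div_assoc']
  rw [← hσ2, e4, ← mul_pow] at hA hB
  have hi1 : (1 : ℝ) ≤ 2 ^ i := one_le_pow₀ (by norm_num)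
  have hA' : σ * M ≤ 2 * 2 ^ i := by
    refine le_of_sq_le_sq ?_ (by positivity)
    rw [mul_pow 2]
    linarith
  have hB' : (2 : ℝ) ^ i ≤ σ * M + 1 := by
    rcases Nat.eq_zero_or_pos i with h0 | h0
    · rw [h0, pow_zero]
      have := mul_nonneg hσ0 hM0.le
      linarith
    · have := le_of_sq_le_sq (hB h0.ne') (by positivity)
      linarith
  constructor
  · gcongr
  · gcongr
    linarith

theorem dGridSet_lglPartition_finite (m : ℕ) : (dGridSet (lglPartition m)).Finite :=
  (lglPartition m).ps.finite_toSet.biUnion fun _ _ => Set.toFinite _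

theorem two_pow_le_ncard_dGridSet (m : ℕ) :
    2 * 2 ^ m ≤ (dGridSet (lglPartition m)).ncard := by
  have h4 : (0 : ℝ) < 4 ^ m := by positivity
  have hinj : Function.Injective fun k : ℕ => -1 + ((2 ^ m * k : ℕ) : ℝ) / 4 ^ m := by
    intro k l h
    have h' := (div_left_inj' h4.ne').1 (add_left_cancel h)
    exact Nat.eq_of_mul_eq_mul_left (by positivity) (Nat.cast_injective h')
  have hsub : (((Finset.range (2 * 2 ^ m)).image
      fun k : ℕ => -1 + ((2 ^ m * k : ℕ) : ℝ) / 4 ^ m : Finset ℝ) : Set ℝ)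
      ⊆ dGridSet (lglPartition m) := by
    intro x hx
    obtain ⟨k, hk, rfl⟩ := Finset.mem_image.1 hx
    rw [Finset.mem_range] at hk
    refine mem_dGridSet_lglPartition.2 ⟨2 ^ m * k, ?_, fun h => ?_, rfl⟩
    · rw [four_pow_eq_two_pow_mul, mul_left_comm]
      gcongr
    · exact (pow_dvd_pow 2 (lglLevel_le h)).mul_right k
  calc 2 * 2 ^ m = ((Finset.range (2 * 2 ^ m)).image
        fun k : ℕ => -1 + ((2 ^ m * k : ℕ) : ℝ) / 4 ^ m).card := by
        rw [Finset.card_image_of_injective _ hinj, Finset.card_range]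
    _ ≤ _ := by
        rw [← Set.ncard_coe_finset]
        exact Set.ncard_le_ncard hsub (dGridSet_lglPartition_finite m)

theorem ncard_dGridSet_le (m : ℕ) : (dGridSet (lglPartition m)).ncard ≤ 20 * 2 ^ m := by
  set S : Finset ℕ := (Finset.range (m + 1)).biUnion fun i =>
    (Finset.range (2 ^ (i + 2) + 1)).image fun k => 2 ^ i * k with hS
  have hScard : S.card ≤ 9 * 2 ^ m := by
    have h1 : S.card ≤ ∑ i ∈ Finset.range (m + 1), (2 ^ (i + 2) + 1) :=
      Finset.card_biUnion_le.trans (Finset.sum_le_sum fun i _ =>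
        Finset.card_image_le.trans (Finset.card_range _).le)
    have h2 : ∀ j, ∑ i ∈ Finset.range j, (2 ^ (i + 2) + 1) + 4 = 4 * 2 ^ j + j := by
      intro j
      induction j with
      | zero => rfl
      | succ j ih =>
        rw [Finset.sum_range_succ, add_right_comm, ih]
        ring
    have h3 := h2 (m + 1)
    have h4 : m < 2 ^ m := Nat.lt_two_pow_self
    rw [pow_succ] at h3
    omega
  have hmem : ∀ i ≤ m, ∀ w, 2 ^ i ∣ w → w ≤ 4 ^ (i + 1) → w ∈ S := by
    rintro i hi _ ⟨k, rfl⟩ hk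
    refine Finset.mem_biUnion.2 ⟨i, Finset.mem_range.2 (Nat.lt_succ_of_le hi),
      Finset.mem_image.2 ⟨k, Finset.mem_range.2 (Nat.lt_succ_of_le ?_), rfl⟩⟩
    rw [pow_succ, four_pow_eq_two_pow_mul, mul_assoc] at hk
    rw [pow_add]
    exact le_of_mul_le_mul_left hk (by positivity)
  have hsub : dGridSet (lglPartition m) ⊆
      ((S.image (fun v : ℕ => -1 + (v : ℝ) / 4 ^ m) ∪
        S.image (fun v : ℕ => 1 - (v : ℝ) / 4 ^ m) : Finset ℝ) : Set ℝ) := by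
    intro x hx
    obtain ⟨v, hv, hdvd, rfl⟩ := mem_dGridSet_lglPartition.1 hx
    have key : v ∈ S ∨ 2 * 4 ^ m - v ∈ S := by
      rcases hv.eq_or_lt with rfl | hlt
      · right
        rw [Nat.sub_self]
        exact hmem 0 (Nat.zero_le m) 0 (dvd_zero _) (Nat.zero_le _)
      · have hlog : min v (2 * 4 ^ m - 1 - v) < 4 ^ (lglLevel m v + 1) :=
          Nat.lt_pow_succ_log_self (by norm_num) _
        have hl := lglLevel_le hlt
        rcases min_lt_iff.1 hlog with h | h
        · exact Or.inl (hmem _ hl _ (hdvd hlt) h.le)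
        · exact Or.inr (hmem _ hl _ (Nat.dvd_sub (two_pow_dvd_total hl) (hdvd hlt)) (by omega))
    rw [Finset.mem_coe, Finset.mem_union, Finset.mem_image, Finset.mem_image]
    refine key.imp (fun h => ⟨v, h, rfl⟩) (fun h => ⟨_, h, ?_⟩)
    rw [Nat.cast_sub hv]
    push_cast
    field_simp
    ring
  calc (dGridSet (lglPartition m)).ncard
      ≤ (S.image (fun v : ℕ => -1 + (v : ℝ) / 4 ^ m) ∪
        S.image (fun v : ℕ => 1 - (v : ℝ) / 4 ^ m)).card := by
        rw [← Set.ncard_coe_finset]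
        exact Set.ncard_le_ncard hsub (Finset.finite_toSet _)
    _ ≤ S.card + S.card := (Finset.card_union_le _ _).trans
        (add_le_add Finset.card_image_le Finset.card_image_le)
    _ ≤ 20 * 2 ^ m := by omega

theorem dLen_pos (p : ℕ × ℕ) : 0 < dLen (-1) 1 p := by
  unfold dLen
  positivity

theorem lglPartition_quasiUniform (m : ℕ) : (lglPartition m).QuasiUniform 3 := by
  rintro p hp q hq ⟨x, hxp, hxq⟩
  obtain ⟨h1, h2⟩ := dLen_lglPartition_bounds hp hxp
  obtain ⟨h3, h4⟩ := dLen_lglPartition_bounds hq hxq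
  rw [le_div_iff₀ (dLen_pos q), div_le_iff₀ (dLen_pos q)]
  constructor <;> linarith

/-- Existence of nested dyadic grids associated with the LGL grids: there are
constants `0 < A ≤ B`, `C ≥ 1`, `c₁, c₂ > 0` and, for each `N ≥ 1`, a dyadic
partition `P N` of `[-1,1]` whose associated dyadic grid `𝒟_N` is
(i) symmetric and monotonic, (ii) locally quasi-uniform with constant `C`,
(iii) nested (`𝒟_N ⊆ 𝒟_{N+1}`), (iv) locally `(A,B)`-uniformly equivalent to
the LGL grid of order `N`, and (v) of cardinality comparable to `N`:
`c₁·N ≤ #𝒟_N ≤ c₂·N`. -/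
theorem exists_nested_dyadic_lgl_grids :
    ∃ A B C c₁ c₂ : ℝ, 0 < A ∧ A ≤ B ∧ 1 ≤ C ∧ 0 < c₁ ∧ 0 < c₂ ∧
      ∃ P : ℕ → DyadicPartition (-1 : ℝ) 1,
        ∀ N : ℕ, 1 ≤ N →
          ((P N).SymmetricGrid ∧ (P N).Monotonic) ∧
          (P N).QuasiUniform C ∧
          dGridSet (P N) ⊆ dGridSet (P (N + 1)) ∧
          (∀ ξ : ℕ → ℝ, IsLGLNodes N ξ → ∀ p ∈ (P N).ps, ∀ i < N,
            (dInt (-1) 1 p ∩ Set.Icc (ξ i) (ξ (i + 1))).Nonempty →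
            A ≤ dLen (-1) 1 p / (ξ (i + 1) - ξ i) ∧
            dLen (-1) 1 p / (ξ (i + 1) - ξ i) ≤ B) ∧
          (c₁ * N ≤ ((dGridSet (P N)).ncard : ℝ) ∧
            ((dGridSet (P N)).ncard : ℝ) ≤ c₂ * N) := by
  refine ⟨1 / 60, 12, 3, 1, 20, by norm_num, by norm_num, by norm_num, by norm_num, by norm_num,
    fun N => lglPartition (Nat.log 2 N), fun N hN => ?_⟩
  have hlo : 2 ^ Nat.log 2 N ≤ N := Nat.pow_log_le_self 2 (by omega)
  have hhi : N < 2 * 2 ^ Nat.log 2 N := by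
    rw [← pow_succ']
    exact Nat.lt_pow_succ_log_self (by norm_num) N
  refine ⟨⟨lglPartition_symmetricGrid _, lglPartition_monotonic _⟩, lglPartition_quasiUniform _,
    ?_, ?_, ?_, ?_⟩
  · have h1 : Nat.log 2 N ≤ Nat.log 2 (N + 1) := Nat.log_mono_right (Nat.le_succ N)
    exact monotone_nat_of_le_succ (f := fun m => dGridSet (lglPartition m))
      dGridSet_lglPartition_subset_succ h1
  · rintro ξ hξ p hp i hi ⟨x, hxp, hxi⟩
    have hM : (0 : ℝ) < 2 ^ Nat.log 2 N := by positivity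
    have hlo' : (2 : ℝ) ^ Nat.log 2 N ≤ N := by exact_mod_cast hlo
    have hhi' : (N : ℝ) ≤ 2 * 2 ^ Nat.log 2 N := by exact_mod_cast hhi.le
    obtain ⟨h1, h2⟩ := dLen_lglPartition_bounds hp hxp
    obtain ⟨h3, h4⟩ := hξ.gap_bounds hN hi hxi
    have h5 := meshSize_anti hM hlo' x
    have h6 := meshSize_le_four_mul hM hlo' hhi' x
    have h7 := meshSize_pos (hM.trans_le hlo') x
    have h8 : 0 < ξ (i + 1) - ξ i := by linarith
    rw [le_div_iff₀ h8, div_le_iff₀ h8]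
    constructor <;> linarith
  · rw [one_mul]
    exact_mod_cast hhi.le.trans (two_pow_le_ncard_dGridSet _)
  · exact_mod_cast (ncard_dGridSet_le _).trans (Nat.mul_le_mul_left 20 hlo)
end

section
/- Level bound for the output of the dyadic grid algorithm: let G be a grid on [a,b], let h = min{|Δ| : Δ ∈ P(G)}, let α > 0, and let P be an α-output for (G, {[a,b]}), where {[a,b]} denotes the trivial dyadic partition consisting of the single interval [a,b]. Then every D ∈ P is a standard dyadic subinterval of [a,b] of level at most max{⌈log₂((b−a)/(α·h))⌉, 0}. -/
theorem dInt_subset_dInt_dParent {a b : ℝ} (hab : a ≤ b) {p : ℕ × ℕ} (hp : 1 ≤ p.1) :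
    dInt a b p ⊆ dInt a b (dParent p) := by
  obtain ⟨j, k⟩ := p
  obtain ⟨i, rfl⟩ : ∃ i, j = i + 1 := ⟨j - 1, (Nat.sub_add_cancel hp).symm⟩
  have hl : (2 : ℝ) * (k / 2 : ℕ) ≤ k := by exact_mod_cast Nat.mul_div_le k 2
  have hr : (k : ℝ) + 1 ≤ 2 * ((k / 2 : ℕ) + 1) := by
    have : k + 1 ≤ 2 * (k / 2 + 1) := by omega
    exact_mod_cast this
  have hba : 0 ≤ b - a := sub_nonneg.2 hab
  have double (c : ℝ) : (b - a) * c / 2 ^ i = (b - a) * (2 * c) / 2 ^ (i + 1) := by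
    field_simp
    ring
  apply Set.Icc_subset_Icc <;> simp only [dParent, Nat.add_sub_cancel, double] <;> gcongr

theorem Grid.step_pos {a b : ℝ} (G : Grid a b) {i : ℕ} (hi : i < G.M) :
    0 < G.x (i + 1) - G.x i :=
  sub_pos.2 (G.mono (Set.mem_Iic.2 hi.le) (Set.mem_Iic.2 hi) i.lt_succ_self)

theorem Grid.sInf_step_pos {a b : ℝ} (G : Grid a b) :
    0 < sInf {d : ℝ | ∃ i < G.M, d = G.x (i + 1) - G.x i} := by
  set S : Set ℝ := {d : ℝ | ∃ i < G.M, d = G.x (i + 1) - G.x i}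
  have hfin : S.Finite := by
    refine ((Set.finite_Iio G.M).image fun i => G.x (i + 1) - G.x i).subset ?_
    rintro d ⟨i, hi, rfl⟩
    exact ⟨i, hi, rfl⟩
  obtain ⟨i, hi, h⟩ := Set.Nonempty.csInf_mem (s := S) ⟨_, 0, G.M_pos, rfl⟩ hfin
  rw [h]
  exact G.step_pos hi

/-- The minimal grid length near `J` is at least the global one, as soon as a subset `I` of `J`
meets the grid, which a positive value of `G.gmin I` guarantees. -/
theorem Grid.sInf_step_le_gmin {a b : ℝ} (G : Grid a b) {I J : Set ℝ} (hIJ : I ⊆ J)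
    (hI : 0 < G.gmin I) :
    sInf {d : ℝ | ∃ i < G.M, d = G.x (i + 1) - G.x i} ≤ G.gmin J := by
  refine csInf_le_csInf ⟨0, ?_⟩ ?_ ?_
  · rintro d ⟨i, hi, rfl⟩
    exact (G.step_pos hi).le
  · by_contra hne
    have hempty : {d : ℝ | ∃ i < G.M, (G.interval i ∩ I).Nonempty ∧
        d = G.x (i + 1) - G.x i} = ∅ := by
      refine Set.eq_empty_of_forall_notMem ?_
      rintro d ⟨i, hi, hn, hd⟩
      exact hne ⟨d, i, hi, hn.mono (Set.inter_subset_inter_right _ hIJ), hd⟩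
    rw [Grid.gmin, hempty, Real.sInf_empty] at hI
    exact hI.false
  · rintro d ⟨i, hi, -, hd⟩
    exact ⟨i, hi, hd⟩

/-- Level bound for the output of the dyadic grid algorithm: if
`h = min {|Δ| : Δ ∈ P(G)}` and `P` is an α-output for `(G, {[a,b]})`, then
every interval of `P` has dyadic level at most
`max ⌈log₂((b-a)/(α·h))⌉ 0`. -/
theorem dyadic_output_level_bound {a b : ℝ} (hab : a < b) (G : Grid a b)
    (h : ℝ) (hh : h = sInf {d : ℝ | ∃ i < G.M, d = G.x (i + 1) - G.x i})
    (α : ℝ) (hα : 0 < α)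
    (P₀ P : DyadicPartition a b) (hP₀ : P₀.ps = {(0, 0)})
    (hP : IsAlphaOutput G P₀ P α) :
    ∀ p ∈ P.ps, (p.1 : ℤ) ≤ max ⌈Real.logb 2 ((b - a) / (α * h))⌉ 0 := by
  intro p hp
  obtain ⟨-, hle, hgt⟩ := hP
  by_cases h0 : p = (0, 0)
  · simp [h0]
  obtain ⟨hp1, hpar⟩ := hgt p hp (by simpa [hP₀] using h0)
  have hlen : 0 < dLen a b p := div_pos (sub_pos.2 hab) (by positivity)
  have hgmin : 0 < G.gmin (dInt a b p) := pos_of_mul_pos_right (hlen.trans_le (hle p hp)) hα.le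
  have hh_le : h ≤ G.gmin (dInt a b (dParent p)) :=
    hh ▸ G.sInf_step_le_gmin (dInt_subset_dInt_dParent hab.le hp1) hgmin
  have hh_pos : 0 < h := hh ▸ G.sInf_step_pos
  have hlt : α * h < (b - a) / 2 ^ (p.1 - 1) :=
    (mul_le_mul_of_nonneg_left hh_le hα.le).trans_lt hpar
  have hpow : (2 : ℝ) ^ (p.1 - 1) < (b - a) / (α * h) := by
    rw [lt_div_iff₀ (by positivity)] at hlt ⊢
    linarith
  have hlog : ((p.1 - 1 : ℕ) : ℝ) < Real.logb 2 ((b - a) / (α * h)) := by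
    rw [Real.lt_logb_iff_rpow_lt one_lt_two (lt_trans (by positivity) hpow), Real.rpow_natCast]
    exact hpow
  have hceil : ((p.1 - 1 : ℕ) : ℤ) < ⌈Real.logb 2 ((b - a) / (α * h))⌉ :=
    Int.lt_ceil.2 (by exact_mod_cast hlog)
  exact le_max_of_le_left (by omega)
end
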